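/- For every c ≤ 1 the entire spacelike graph of u_c in Minkowski space is complete with respect to the induced metric. Precisely: for every T ∈ (0, ∞] and every C¹ curve γ : [0, T) → ℝⁿ such that |γ(s)| → ∞ as s → T, one has ∫₀^T √( |γ'(s)|² − ((u_c ∘ γ)'(s))² ) ds = +∞. -/

import Mathlib

open Real Filter

/-- A global spacelike solution: a `C²` function `f : ℝ → ℝ` with `|f'| < 1` and
`f'' = f^(n-1) (1 - f'^2)^((n+2)/2)` on all of `ℝ`. -/
def IsGSS (n : ℕ) (f : ℝ → ℝ) : Prop :=
  ContDiff ℝ 2 f ∧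
  ∀ t : ℝ, |deriv f t| < 1 ∧
    deriv (deriv f) t = f t ^ (n - 1) * (1 - (deriv f t) ^ 2) ^ ((n + 2 : ℝ) / 2)

/-- `IsFc n c f` says that `f` is the normalized global spacelike solution `f_c`:
for `c < 1` it satisfies `f 0 = (1-c)^(1/n)`, `f' 0 = 0` (so its first integral is `c`);
for `c = 1` it satisfies `f 0 = 1`, `f' 0 = √(1 - 2^(-2/n))` (first integral `1`,
and `f` is strictly increasing). -/
def IsFc (n : ℕ) (c : ℝ) (f : ℝ → ℝ) : Prop :=
  IsGSS n f ∧
  (c < 1 → f 0 = (1 - c) ^ ((1 : ℝ) / n) ∧ deriv f 0 = 0) ∧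
  (c = 1 → f 0 = 1 ∧ deriv f 0 = Real.sqrt (1 - (2 : ℝ) ^ (-(2 : ℝ) / n)))

/-- The rotationally symmetric function `u_c(x) = √(f_c(x₁)² + |x̄|²)` on `ℝⁿ`
(written using `|x̄|² = ‖x‖² - x₁²`). -/
noncomputable def uC (n : ℕ) (f : ℝ → ℝ) (x : EuclideanSpace ℝ (Fin (n + 2))) : ℝ :=
  Real.sqrt (f (x 0) ^ 2 + ‖x‖ ^ 2 - (x 0) ^ 2)

theorem IsGSS.hasDerivAt {m : ℕ} {f : ℝ → ℝ} (hf : IsGSS m f) (t : ℝ) :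
    HasDerivAt f (deriv f t) t :=
  (hf.1.differentiable (by norm_num)).differentiableAt.hasDerivAt

theorem IsGSS.one_sub_deriv_sq_pos {m : ℕ} {f : ℝ → ℝ} (hf : IsGSS m f) (t : ℝ) :
    0 < 1 - deriv f t ^ 2 := by
  have h := (sq_lt_one_iff_abs_lt_one _).2 (hf.2 t).1
  linarith

/-- The first integral `(1 - f'²)^(-m/2) - f^m` is constant. -/
theorem IsGSS.first_integral {m : ℕ} {f : ℝ → ℝ} (hf : IsGSS m f) (t : ℝ) :
    (1 - deriv f t ^ 2) ^ (-((m : ℝ) / 2)) - f t ^ m =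
      (1 - deriv f 0 ^ 2) ^ (-((m : ℝ) / 2)) - f 0 ^ m := by
  have hd : ∀ t, HasDerivAt
      (fun t => (1 - deriv f t ^ 2) ^ (-((m : ℝ) / 2)) - f t ^ m) 0 t := by
    intro t
    have hv := hf.one_sub_deriv_sq_pos t
    have h2 : HasDerivAt (deriv f) (deriv (deriv f) t) t := by
      have hC : ContDiff ℝ 1 (deriv f) :=
        ((contDiff_succ_iff_deriv (n := 1)).1 (by simpa [one_add_one_eq_two] using hf.1)).2.2
      exact (hC.differentiable (by norm_num)).differentiableAt.hasDerivAt
    have h := (((h2.pow 2).const_sub 1).rpow_const (p := -((m : ℝ) / 2))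
      (Or.inl hv.ne')).sub ((hf.hasDerivAt t).pow m)
    refine h.congr_deriv ?_
    have hm : (1 - deriv f t ^ 2) ^ (-((m : ℝ) / 2) - 1) *
        (1 - deriv f t ^ 2) ^ (((m : ℝ) + 2) / 2) = 1 := by
      rw [← rpow_add hv]
      ring_nf
      exact rpow_zero _
    rw [(hf.2 t).2]
    simp only [Nat.add_one_sub_one, pow_one, Nat.cast_ofNat, Pi.pow_apply]
    linear_combination (deriv f t * f t ^ (m - 1) * m) * hm
  exact is_const_of_deriv_eq_zero (fun t => (hd t).differentiableAt)
    (fun t => (hd t).deriv) t 0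

theorem IsFc.first_integral {m : ℕ} (hm : m ≠ 0) {c : ℝ} (hc : c ≤ 1) {f : ℝ → ℝ}
    (hf : IsFc m c f) (t : ℝ) :
    (1 - deriv f t ^ 2) ^ (-((m : ℝ) / 2)) = c + f t ^ m := by
  have h := hf.1.first_integral t
  have hm' : (m : ℝ) ≠ 0 := by exact_mod_cast hm
  rcases hc.lt_or_eq with hc | hc
  · obtain ⟨h0, h1⟩ := hf.2.1 hc
    rw [h1, h0, one_div, rpow_inv_natCast_pow (by linarith) hm] at h
    norm_num at h
    linarith
  · obtain ⟨h0, h1⟩ := hf.2.2 hc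
    have hle : (2 : ℝ) ^ (-(2 : ℝ) / m) ≤ 1 :=
      rpow_le_one_of_one_le_of_nonpos (by norm_num)
        (div_nonpos_of_nonpos_of_nonneg (by norm_num) (by positivity))
    rw [h1, h0, sq_sqrt (by linarith), sub_sub_cancel, ← rpow_mul (by norm_num)] at h
    have he : -(2 : ℝ) / m * -((m : ℝ) / 2) = 1 := by field_simp
    rw [he] at h
    norm_num at h
    linarith

theorem IsFc.one_le {m : ℕ} (hm : m ≠ 0) {c : ℝ} (hc : c ≤ 1) {f : ℝ → ℝ}
    (hf : IsFc m c f) (t : ℝ) : 1 ≤ c + f t ^ m := by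
  rw [← hf.first_integral hm hc t]
  exact one_le_rpow_of_pos_of_le_one_of_nonpos (hf.1.one_sub_deriv_sq_pos t)
    (by nlinarith [sq_nonneg (deriv f t)])
    (by have : (0 : ℝ) ≤ m := by positivity
        linarith)

theorem IsFc.one_sub_deriv_sq {m : ℕ} (hm : m ≠ 0) {c : ℝ} (hc : c ≤ 1) {f : ℝ → ℝ}
    (hf : IsFc m c f) (t : ℝ) : 1 - deriv f t ^ 2 = (c + f t ^ m) ^ (-(2 / (m : ℝ))) := by
  have hm' : (m : ℝ) ≠ 0 := by exact_mod_cast hm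
  rw [← hf.first_integral hm hc t, ← rpow_mul (hf.1.one_sub_deriv_sq_pos t).le]
  have he : -((m : ℝ) / 2) * -(2 / (m : ℝ)) = 1 := by field_simp
  rw [he, rpow_one]

/-- For `c = 1` the solution satisfies `|f'| ≤ |f|`. -/
theorem IsFc.deriv_sq_le {m : ℕ} (hm : 2 ≤ m) {f : ℝ → ℝ}
    (hf : IsFc m 1 f) (t : ℝ) : deriv f t ^ 2 ≤ f t ^ 2 := by
  have hm0 : m ≠ 0 := by omega
  have h1 := hf.one_le hm0 le_rfl t
  have hpos := hf.1.one_sub_deriv_sq_pos t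
  rcases le_total 1 |f t| with h | h
  · have := (one_le_sq_iff_one_le_abs _).2 h
    linarith
  have hv := hf.one_sub_deriv_sq hm0 le_rfl t
  have hmR : (2 : ℝ) ≤ m := by exact_mod_cast hm
  have h2 : (1 + f t ^ m) ^ (-(1 : ℝ)) ≤ (1 + f t ^ m) ^ (-(2 / (m : ℝ))) := by
    apply rpow_le_rpow_of_exponent_le h1
    rw [neg_le_neg_iff, div_le_one (by linarith)]
    exact hmR
  rw [rpow_neg_one, ← hv] at h2
  have h3 : f t ^ m ≤ f t ^ 2 := by
    calc f t ^ m ≤ |f t ^ m| := le_abs_self _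
      _ = |f t| ^ m := abs_pow _ _
      _ ≤ |f t| ^ 2 := pow_le_pow_of_le_one (abs_nonneg _) h hm
      _ = f t ^ 2 := sq_abs _
  have h4 : 1 - f t ^ m ≤ (1 + f t ^ m)⁻¹ := by
    rw [← one_div, le_div_iff₀ (by linarith)]
    nlinarith [sq_nonneg (f t ^ m)]
  linarith

theorem ne_zero_of_deriv_sq_le {f : ℝ → ℝ} (hd : Differentiable ℝ f)
    (h : ∀ t, deriv f t ^ 2 ≤ f t ^ 2) (h0 : f 0 ≠ 0) (t : ℝ) : f t ≠ 0 := by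
  have hder : ∀ k t : ℝ, HasDerivAt (fun t => f t ^ 2 * exp (k * t))
      ((2 * f t * deriv f t + k * f t ^ 2) * exp (k * t)) t := by
    intro k t
    have h1 := (hd t).hasDerivAt.pow 2
    have h2 := ((hasDerivAt_id t).const_mul k).exp
    refine (h1.mul h2).congr_deriv ?_
    simp
    ring
  have hab : ∀ t, |f t * deriv f t| ≤ f t ^ 2 := by
    intro t
    rw [abs_mul, ← sq_abs (f t), sq]
    exact mul_le_mul_of_nonneg_left (sq_le_sq.1 (h t)) (abs_nonneg _)
  intro ht
  rcases le_total 0 t with h' | h'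
  · have hm : Monotone (fun t => f t ^ 2 * exp (2 * t)) := by
      refine monotone_of_hasDerivAt_nonneg (hder 2) fun s => mul_nonneg ?_ (exp_pos _).le
      have := abs_le.1 (hab s)
      nlinarith
    have := hm h'
    exact h0 (by simpa [ht] using this)
  · have hm : Antitone (fun t => f t ^ 2 * exp (-2 * t)) := by
      refine antitone_of_hasDerivAt_nonpos (hder (-2)) fun s =>
        mul_nonpos_of_nonpos_of_nonneg ?_ (exp_pos _).le
      have := abs_le.1 (hab s)
      nlinarith
    have := hm h'
    exact h0 (by simpa [ht] using this)

theorem IsFc.pos {m : ℕ} (hm : 2 ≤ m) {c : ℝ} (hc : c ≤ 1) {f : ℝ → ℝ}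
    (hf : IsFc m c f) (t : ℝ) : 0 < f t := by
  have hm0 : m ≠ 0 := by omega
  have hd : Differentiable ℝ f := fun t => (hf.1.hasDerivAt t).differentiableAt
  have key : 0 < f 0 ∧ ∀ t, f t ≠ 0 := by
    rcases hc.lt_or_eq with hc' | rfl
    · refine ⟨?_, fun t ht => ?_⟩
      · rw [(hf.2.1 hc').1]
        exact rpow_pos_of_pos (by linarith) _
      · have := hf.one_le hm0 hc t
        rw [ht, zero_pow hm0] at this
        linarith
    · have h0 := (hf.2.2 rfl).1
      refine ⟨by rw [h0]; norm_num, ne_zero_of_deriv_sq_le hd (hf.deriv_sq_le hm) ?_⟩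
      rw [h0]
      norm_num
  by_contra hle
  obtain ⟨s, hs⟩ := intermediate_value_univ t 0 hd.continuous ⟨not_lt.1 hle, key.1.le⟩
  exact key.2 s hs

theorem IsFc.inv_le_one_sub_deriv_sq {m : ℕ} (hm : 2 ≤ m) {c : ℝ} (hc : c ≤ 1) {f : ℝ → ℝ}
    (hf : IsFc m c f) (t : ℝ) : ((1 + f t) ^ 2)⁻¹ ≤ 1 - deriv f t ^ 2 := by
  have hm0 : m ≠ 0 := by omega
  have hm' : (m : ℝ) ≠ 0 := by exact_mod_cast hm0
  have hp := hf.pos hm hc t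
  have h1 := hf.one_le hm0 hc t
  have h2 : c + f t ^ m ≤ (1 + f t) ^ m := by
    have := pow_add_pow_le zero_le_one hp.le hm0
    rw [one_pow] at this
    linarith
  rw [hf.one_sub_deriv_sq hm0 hc t]
  calc ((1 + f t) ^ 2)⁻¹ = ((1 + f t) ^ m) ^ (-(2 / (m : ℝ))) := by
        rw [← rpow_natCast (1 + f t) m, ← rpow_mul (by linarith)]
        have : (m : ℝ) * -(2 / (m : ℝ)) = -2 := by field_simp
        rw [this, rpow_neg (by linarith), rpow_two]
    _ ≤ _ := rpow_le_rpow_of_nonpos (by linarith) h2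
        (neg_nonpos.2 (by positivity))

theorem IsGSS.le_add_abs {m : ℕ} {f : ℝ → ℝ} (hf : IsGSS m f) (t : ℝ) :
    f t ≤ f 0 + |t| := by
  have h := Convex.norm_image_sub_le_of_norm_deriv_le (f := f) (C := 1) (s := Set.univ)
    (x := 0) (y := t) (fun x _ => (hf.hasDerivAt x).differentiableAt)
    (fun x _ => (hf.2 x).1.le) convex_univ trivial trivial
  simp only [norm_eq_abs, sub_zero, one_mul] at h
  linarith [le_abs_self (f t - f 0)]

/-- Cauchy–Schwarz for the components of two vectors orthogonal to the first coordinate axis. -/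
theorem inner_sub_sq_le {n : ℕ} (x y : EuclideanSpace ℝ (Fin (n + 2))) :
    (inner ℝ x y - x 0 * y 0) ^ 2 ≤ (‖x‖ ^ 2 - x 0 ^ 2) * (‖y‖ ^ 2 - y 0 ^ 2) := by
  have h := Finset.sum_mul_sq_le_sq_mul_sq Finset.univ (fun i : Fin (n + 1) => x i.succ)
    (fun i => y i.succ)
  rw [EuclideanSpace.real_norm_sq_eq, EuclideanSpace.real_norm_sq_eq, PiLp.inner_apply,
    Fin.sum_univ_succ, Fin.sum_univ_succ (fun i => x i ^ 2),
    Fin.sum_univ_succ (fun i => y i ^ 2)]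
  simp only [RCLike.inner_apply, conj_trivial, add_sub_cancel_left, mul_comm (y _) (x _)]
  exact h

theorem sq_coord_le {n : ℕ} (x : EuclideanSpace ℝ (Fin (n + 2))) : x 0 ^ 2 ≤ ‖x‖ ^ 2 := by
  rw [EuclideanSpace.real_norm_sq_eq]
  exact Finset.single_le_sum (f := fun i => x i ^ 2) (fun i _ => sq_nonneg _) (Finset.mem_univ 0)

/-- The induced metric dominates `(1 - f'²) dx₁²`; here `g = f(x₁)`, `p = x̄ · dx̄`, `a = dx₁`,
`R = |x̄|²`, `B = |dx̄|²` and `s = du`. -/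
theorem radial_sq_le {u g d a p R B s : ℝ} (hu : 0 < u) (hR : 0 ≤ R) (hB : 0 ≤ B)
    (hug : u ^ 2 = g ^ 2 + R) (hs : u * s = g * (d * a) + p) (hp : p ^ 2 ≤ R * B) :
    s ^ 2 ≤ (d * a) ^ 2 + B := by
  have hu2 : 0 < u ^ 2 := by positivity
  refine le_of_mul_le_mul_left ?_ hu2
  have h1 : u ^ 2 * s ^ 2 = (g * (d * a) + p) ^ 2 := by rw [← hs]; ring
  rw [h1, hug]
  have h2 : 2 * (g * (d * a)) * p ≤ g ^ 2 * B + R * (d * a) ^ 2 := by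
    have h3 : ((g * (d * a)) * p) ^ 2 ≤ (g ^ 2 * B) * (R * (d * a) ^ 2) := by
      nlinarith [mul_le_mul_of_nonneg_left hp (sq_nonneg (g * (d * a)))]
    have h4 : 0 ≤ g ^ 2 * B + R * (d * a) ^ 2 := by positivity
    nlinarith [abs_le_of_sq_le_sq' (a := 2 * (g * (d * a)) * p)
      (b := g ^ 2 * B + R * (d * a) ^ 2)
      (by nlinarith [sq_nonneg (g ^ 2 * B - R * (d * a) ^ 2)]) h4]
  nlinarith

/-- The induced metric dominates `f² (d log (u / f))²`. -/
theorem angular_sq_le {u g d a p R B s : ℝ} (hu : 0 < u) (hg : 0 < g) (hR : 0 ≤ R) (hB : 0 ≤ B)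
    (hug : u ^ 2 = g ^ 2 + R) (hs : u * s = g * (d * a) + p) (hp : p ^ 2 ≤ R * B)
    (hd : d ^ 2 ≤ 1) : (g * (s / u - d * a / g)) ^ 2 ≤ a ^ 2 + B - s ^ 2 := by
  have h1 := radial_sq_le hu hR hB hug hs hp
  have h2 : (g * (s / u - d * a / g)) ^ 2 = (g * s - u * (d * a)) ^ 2 / u ^ 2 := by
    field_simp
  rw [h2, div_le_iff₀ (by positivity)]
  have hda : (d * a) ^ 2 ≤ a ^ 2 := by nlinarith [sq_nonneg a]
  have hpe : p = u * s - g * (d * a) := by linarith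
  have h3 : (u * s - g * (d * a)) ^ 2 ≤ (u ^ 2 - g ^ 2) * B := by
    rw [← hpe, show u ^ 2 - g ^ 2 = R by linarith]
    exact hp
  nlinarith [mul_le_mul_of_nonneg_left h1 (sq_nonneg g),
    mul_le_mul_of_nonneg_left hda (sq_nonneg u)]

/-- A function whose derivative is dominated by a density of finite total mass is bounded. -/
theorem abs_sub_le_of_lintegral_lt_top {S : Set ℝ} {q h h' : ℝ → ℝ} {K : ℝ}
    (h0S : ∀ s ∈ S, 0 ≤ s ∧ Set.Icc 0 s ⊆ S) (hnhds : ∀ s ∈ S, S ∈ nhdsWithin s (Set.Ioi s))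
    (hq : ContinuousOn q S) (hq0 : ∀ s, 0 ≤ q s) (hK : 0 ≤ K)
    (hfin : ∫⁻ s in S, ENNReal.ofReal (q s) ≠ ⊤)
    (hh : ∀ s ∈ S, HasDerivWithinAt h (h' s) S s) (hb : ∀ s ∈ S, |h' s| ≤ K * q s) :
    ∀ s ∈ S, |h s - h 0| ≤ K * (∫⁻ s in S, ENNReal.ofReal (q s)).toReal := by
  intro s hs
  obtain ⟨hs0, hsub⟩ := h0S s hs
  have hint : MeasureTheory.IntegrableOn q (Set.Icc 0 s) := (hq.mono hsub).integrableOn_Icc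
  have hle : ∫ y in (0 : ℝ)..s, K * q y ≤ K * (∫⁻ s in S, ENNReal.ofReal (q s)).toReal := by
    rw [intervalIntegral.integral_const_mul]
    refine mul_le_mul_of_nonneg_left ?_ hK
    rw [intervalIntegral.integral_of_le hs0,
      MeasureTheory.integral_eq_lintegral_of_nonneg_ae (Eventually.of_forall hq0)
        (hint.mono_set Set.Ioc_subset_Icc_self).aestronglyMeasurable]
    exact ENNReal.toReal_mono hfin
      (MeasureTheory.lintegral_mono_set (Set.Ioc_subset_Icc_self.trans hsub))
  have key : ∀ k k' : ℝ → ℝ, (∀ s ∈ S, HasDerivWithinAt k (k' s) S s) →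
      (∀ s ∈ S, k' s ≤ K * q s) → k s - k 0 ≤ ∫ y in (0 : ℝ)..s, K * q y := by
    intro k k' hk hk'
    refine intervalIntegral.sub_le_integral_of_hasDeriv_right_of_le hs0
      (fun x hx => ((hk x (hsub hx)).continuousWithinAt).mono hsub) (fun x hx => ?_)
      (hint.const_mul K) (fun x hx => hk' x (hsub (Set.Ioo_subset_Icc_self hx)))
    have hxS := hsub (Set.Ioo_subset_Icc_self hx)
    exact (hk x hxS).mono_of_mem_nhdsWithin (hnhds x hxS)
  have h1 := key h h' hh fun s hs => (le_abs_self _).trans (hb s hs)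
  have h2 := key (fun s => -h s) (fun s => -h' s) (fun s hs => (hh s hs).neg)
    fun s hs => (neg_le_abs _).trans (hb s hs)
  rw [abs_le]
  constructor <;> linarith

theorem neBot_comap_coe_nhdsLT {T : EReal} (hT : 0 < T) :
    (comap (fun s : ℝ => (s : EReal)) (nhdsWithin T (Set.Iio T))).NeBot := by
  rw [comap_neBot_iff]
  intro t ht
  obtain ⟨l, hl, hsub⟩ := (mem_nhdsLT_iff_exists_Ioo_subset' hT).1 ht
  obtain ⟨a, hla, haT⟩ := EReal.lt_iff_exists_real_btwn.1 hl
  exact ⟨a, hsub ⟨hla, haT⟩⟩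

/-- for every `c ≤ 1` the graph of `u_c` is complete in the induced
metric from Minkowski space: any `C¹` curve `γ : [0, T) → ℝⁿ` (here `T ∈ (0, ∞]`,
encoded as `T : EReal`) with `|γ(s)| → ∞` as `s → T` has infinite length
`∫₀^T √(|γ'(s)|² - ((u_c ∘ γ)'(s))²) ds = +∞`. -/
theorem stmt_7 (n : ℕ) (c : ℝ) (hc : c ≤ 1) (f : ℝ → ℝ) (hf : IsFc (n + 2) c f)
    (T : EReal) (hT : 0 < T)
    (S : Set ℝ) (hS : S = {s : ℝ | 0 ≤ s ∧ (s : EReal) < T})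
    (γ γ' : ℝ → EuclideanSpace ℝ (Fin (n + 2))) (w : ℝ → ℝ)
    (hγ : ∀ s ∈ S, HasDerivWithinAt γ (γ' s) S s)
    (hγ' : ContinuousOn γ' S)
    (hw : ∀ s ∈ S, HasDerivWithinAt (fun s => uC n f (γ s)) (w s) S s)
    (hdiv : Tendsto (fun s => ‖γ s‖)
      (Filter.comap (fun s : ℝ => (s : EReal)) (nhdsWithin T (Set.Iio T))) atTop) :
    ∫⁻ s in S, ENNReal.ofReal (Real.sqrt (‖γ' s‖ ^ 2 - (w s) ^ 2)) = ⊤ := by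
  have hm : 2 ≤ n + 2 := by omega
  have hmem : ∀ s, s ∈ S ↔ 0 ≤ s ∧ (s : EReal) < T := fun s => by rw [hS]; rfl
  have h0S : ∀ s ∈ S, 0 ≤ s ∧ Set.Icc 0 s ⊆ S := fun s hs =>
    ⟨((hmem s).1 hs).1, fun x hx => (hmem x).2
      ⟨hx.1, (EReal.coe_le_coe_iff.2 hx.2).trans_lt ((hmem s).1 hs).2⟩⟩
  have hnhds : ∀ s ∈ S, S ∈ nhdsWithin s (Set.Ioi s) := by
    intro s hs
    obtain ⟨hs0, hsT⟩ := (hmem s).1 hs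
    obtain ⟨b, hsb, hbT⟩ := EReal.lt_iff_exists_real_btwn.1 hsT
    refine mem_of_superset (Ioo_mem_nhdsGT (EReal.coe_lt_coe_iff.1 hsb)) fun x hx => ?_
    exact (hmem x).2 ⟨hs0.trans hx.1.le, (EReal.coe_lt_coe_iff.2 hx.2).trans hbT⟩
  have hfd := hf.1.hasDerivAt
  have hfc : Continuous f := hf.1.1.continuous
  have hfc' : Continuous (deriv f) := hf.1.1.continuous_deriv (by norm_num)
  have hfpos := hf.pos hm hc
  have hd1 : ∀ t, deriv f t ^ 2 ≤ 1 := fun t => by linarith [hf.1.one_sub_deriv_sq_pos t]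
  have hR : ∀ x : EuclideanSpace ℝ (Fin (n + 2)), 0 ≤ ‖x‖ ^ 2 - x 0 ^ 2 := fun x =>
    sub_nonneg.2 (sq_coord_le x)
  have hu2 : ∀ x, uC n f x ^ 2 = f (x 0) ^ 2 + (‖x‖ ^ 2 - x 0 ^ 2) := fun x => by
    rw [uC, sq_sqrt, add_sub_assoc]
    nlinarith [hR x, sq_nonneg (f (x 0))]
  have hu : ∀ x, 0 < uC n f x := fun x => by
    refine sqrt_pos.2 ?_
    nlinarith [hR x, pow_pos (hfpos (x 0)) 2]
  have hx1 : ∀ s ∈ S, HasDerivWithinAt (fun s => γ s 0) (γ' s 0) S s := fun s hs =>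
    (EuclideanSpace.proj (𝕜 := ℝ) (0 : Fin (n + 2))).hasFDerivAt.comp_hasDerivWithinAt s (hγ s hs)
  have hg : ∀ s ∈ S, HasDerivWithinAt (fun s => f (γ s 0)) (deriv f (γ s 0) * γ' s 0) S s :=
    fun s hs => (hfd (γ s 0)).comp_hasDerivWithinAt s (hx1 s hs)
  have hγc : ContinuousOn γ S := fun s hs => (hγ s hs).continuousWithinAt
  have hx1c : ContinuousOn (fun s => γ s 0) S := fun s hs => (hx1 s hs).continuousWithinAt
  have hy1c : ContinuousOn (fun s => γ' s 0) S :=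
    (EuclideanSpace.proj (𝕜 := ℝ) (0 : Fin (n + 2))).continuous.comp_continuousOn hγ'
  have huc : ContinuousOn (fun s => uC n f (γ s)) S := fun s hs => (hw s hs).continuousWithinAt
  have huw : ∀ s ∈ S, uC n f (γ s) * w s = f (γ s 0) * (deriv f (γ s 0) * γ' s 0) +
      (inner ℝ (γ s) (γ' s) - γ s 0 * γ' s 0) := by
    intro s hs
    have h1 := (hw s hs).pow 2
    have h2 := ((hg s hs).pow 2).add ((hγ s hs).norm_sq.sub ((hx1 s hs).pow 2))
    have h3 : HasDerivWithinAt (fun s => uC n f (γ s) ^ 2) _ S s :=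
      h2.congr_of_mem (fun x _ => hu2 (γ x)) hs
    have hS' := hnhds s hs
    have h4 := (uniqueDiffWithinAt_Ioi s).eq_deriv _ (h1.mono_of_mem_nhdsWithin hS')
      (h3.mono_of_mem_nhdsWithin hS')
    simp at h4
    linarith
  have hwc : ContinuousOn w S := by
    have : ContinuousOn (fun s => (f (γ s 0) * (deriv f (γ s 0) * γ' s 0) +
      (inner ℝ (γ s) (γ' s) - γ s 0 * γ' s 0)) / uC n f (γ s)) S := by
      refine ContinuousOn.div ?_ huc fun s _ => (hu _).ne'
      exact ((hfc.comp_continuousOn hx1c).mul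
        ((hfc'.comp_continuousOn hx1c).mul hy1c)).add ((hγc.inner hγ').sub (hx1c.mul hy1c))
    refine this.congr fun s hs => ?_
    rw [eq_div_iff (hu _).ne', mul_comm, huw s hs]
  have hqc : ContinuousOn (fun s => √(‖γ' s‖ ^ 2 - w s ^ 2)) S :=
    ((hγ'.norm.pow 2).sub (hwc.pow 2)).sqrt
  by_contra hfin
  -- The first coordinate stays bounded.
  have hK : 0 ≤ 2 * (1 + f 0) := by linarith [hfpos 0]
  have hrad : ∀ s ∈ S, |(√(1 + γ s 0 ^ 2))⁻¹ * γ' s 0| ≤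
      2 * (1 + f 0) * √(‖γ' s‖ ^ 2 - w s ^ 2) := by
    intro s hs
    have h1 := radial_sq_le (hu _) (hR _) (hR _) (hu2 _) (huw s hs) (inner_sub_sq_le _ _)
    have h2 := hf.inv_le_one_sub_deriv_sq hm hc (γ s 0)
    have h3 := hf.1.le_add_abs (γ s 0)
    have h4 : 1 + f (γ s 0) ≤ 2 * (1 + f 0) * √(1 + γ s 0 ^ 2) := by
      have h5 : 1 ≤ √(1 + γ s 0 ^ 2) := one_le_sqrt.2 (by nlinarith [sq_nonneg (γ s 0)])
      have h6 : |γ s 0| ≤ √(1 + γ s 0 ^ 2) := abs_le_sqrt (by linarith)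
      nlinarith [hfpos 0]
    have h5 : 0 < 1 + f (γ s 0) := by linarith [hfpos (γ s 0)]
    have h6 : |γ' s 0| / (1 + f (γ s 0)) ≤ √(‖γ' s‖ ^ 2 - w s ^ 2) := by
      refine le_sqrt_of_sq_le ?_
      rw [div_pow, sq_abs, div_eq_mul_inv]
      nlinarith [mul_le_mul_of_nonneg_left h2 (sq_nonneg (γ' s 0))]
    have h7 : 0 < √(1 + γ s 0 ^ 2) := sqrt_pos.2 (by positivity)
    rw [abs_mul, abs_of_pos (inv_pos.2 h7), inv_mul_le_iff₀ h7]
    rw [div_le_iff₀ h5] at h6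
    nlinarith [mul_le_mul_of_nonneg_left h4 (sqrt_nonneg (‖γ' s‖ ^ 2 - w s ^ 2))]
  have hB1 := abs_sub_le_of_lintegral_lt_top h0S hnhds hqc (fun s => sqrt_nonneg _) hK hfin
    (fun s hs => (hasDerivAt_arsinh (γ s 0)).comp_hasDerivWithinAt s (hx1 s hs)) hrad
  obtain ⟨A, hA⟩ : ∃ A, ∀ s ∈ S, |arsinh (γ s 0)| ≤ A :=
    ⟨_, fun s hs => by
      have h1 := hB1 s hs
      have h2 := abs_sub_abs_le_abs_sub (arsinh (γ s 0)) (arsinh (γ 0 0))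
      exact sub_le_iff_le_add.1 (h2.trans h1)⟩
  have hI : ∀ s ∈ S, γ s 0 ∈ Set.Icc (sinh (-A)) (sinh A) := by
    intro s hs
    have h := abs_le.1 (hA s hs)
    rw [← sinh_arsinh (γ s 0)]
    exact ⟨sinh_le_sinh.2 h.1, sinh_le_sinh.2 h.2⟩
  have h0mem : (0 : ℝ) ∈ S := (hmem 0).2 ⟨le_rfl, by simpa using hT⟩
  have hIne : (Set.Icc (sinh (-A)) (sinh A)).Nonempty := ⟨_, hI 0 h0mem⟩
  obtain ⟨a, -, ha⟩ := isCompact_Icc.exists_isMinOn hIne hfc.continuousOn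
  obtain ⟨b, -, hb⟩ := isCompact_Icc.exists_isMaxOn hIne hfc.continuousOn
  have hlow : ∀ s ∈ S, f a ≤ f (γ s 0) := fun s hs => ha (hI s hs)
  have hupp : ∀ s ∈ S, f (γ s 0) ≤ f b := fun s hs => hb (hI s hs)
  -- Hence `log (u / f)` stays bounded, and so does `u`.
  have hang : ∀ s ∈ S, |w s / uC n f (γ s) - deriv f (γ s 0) * γ' s 0 / f (γ s 0)| ≤
      (f a)⁻¹ * √(‖γ' s‖ ^ 2 - w s ^ 2) := by
    intro s hs
    have h1 := angular_sq_le (hu _) (hfpos _) (hR _) (hR _) (hu2 _) (huw s hs)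
      (inner_sub_sq_le _ _) (hd1 _)
    rw [add_sub_cancel] at h1
    have h2 := abs_le_sqrt h1
    rw [abs_mul, abs_of_pos (hfpos _)] at h2
    rw [← div_eq_inv_mul, le_div_iff₀' (hfpos a)]
    exact (mul_le_mul_of_nonneg_right (hlow s hs) (abs_nonneg _)).trans h2
  have hB2 := abs_sub_le_of_lintegral_lt_top h0S hnhds hqc (fun s => sqrt_nonneg _)
    (inv_pos.2 (hfpos a)).le hfin
    (fun s hs => ((hw s hs).log (hu _).ne').sub ((hg s hs).log (hfpos _).ne')) hang
  obtain ⟨D, hD⟩ : ∃ D, ∀ s ∈ S, log (uC n f (γ s)) - log (f (γ s 0)) ≤ D :=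
    ⟨_, fun s hs => sub_le_iff_le_add.1 ((le_abs_self _).trans (hB2 s hs))⟩
  have hub : ∀ s ∈ S, uC n f (γ s) ≤ exp (D + log (f b)) := by
    intro s hs
    rw [← log_le_iff_le_exp (hu _)]
    linarith [hD s hs, log_le_log (hfpos _) (hupp s hs)]
  obtain ⟨M, hM⟩ : ∃ M, ∀ s ∈ S, ‖γ s‖ ≤ M := by
    refine ⟨√(exp (D + log (f b)) ^ 2 + (sinh A) ^ 2), fun s hs => le_sqrt_of_sq_le ?_⟩
    have h1 := hu2 (γ s)
    have h2 := pow_le_pow_left₀ (hu _).le (hub s hs) 2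
    have h3 : γ s 0 ^ 2 ≤ sinh A ^ 2 := by
      have := hI s hs
      rw [sinh_neg] at this
      exact sq_le_sq' this.1 this.2
    nlinarith [sq_nonneg (f (γ s 0))]
  have hne := neBot_comap_coe_nhdsLT hT
  have hev : ∀ᶠ s in comap (fun s : ℝ => (s : EReal)) (nhdsWithin T (Set.Iio T)), s ∈ S := by
    refine mem_of_superset (preimage_mem_comap (Ioo_mem_nhdsLT hT)) fun s hs => ?_
    exact (hmem s).2 ⟨(EReal.coe_pos.1 hs.1).le, hs.2⟩
  obtain ⟨s, hs, hs'⟩ := (hev.and (hdiv.eventually_gt_atTop M)).exists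
  exact (hM s hs).not_gt hs'
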